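/- Let q be a prime power, N ≥ 3, 1 ≤ k ≤ N−1, and let X = F_q^N. Let ρ, ℓ be integers with 2 ≤ ρ ≤ N and ρ ≤ ℓ ≤ (q^ρ−1)/(q−1). Then the number of pairs (P, V), where P is a set of ℓ one-dimensional F_q-subspaces of X whose elements span a subspace of dimension ρ, and V is a k-dimensional subspace of X containing no element of P, equals [N choose k]_q · λ_q(N, k, ℓ, ρ), where λ_q(N, k, ℓ, ρ) = Σ_{i=0}^{ρ} (−1)^{ρ−i} · q^{C(ρ−i,2)} · [N−i choose ρ−i]_q · Σ_{t=0}^{min(k,i)} C((q^i−q^t)/(q−1), ℓ) · [k choose t]_q · [N−k choose i−t]_q · q^{(k−t)(i−t)}. -/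

import Mathlib

/-- The q-binomial (Gaussian) coefficient `[i choose j]_q`, as a rational number, via the
product formula `∏_{l=0}^{j−1} (q^i−q^l)/(q^j−q^l)` (it equals `0` when `j > i`). -/
def qBin (q i j : ℕ) : ℚ :=
  ∏ l ∈ Finset.range j, ((q : ℚ) ^ i - q ^ l) / ((q : ℚ) ^ j - q ^ l)

open Module Submodule

section Counting

variable {F Y : Type*} [Field F] [AddCommGroup Y] [Module F Y]

/-- A tuple is independent modulo `K` iff it is independent and its span meets `K` trivially. -/
theorem linearIndependent_mkQ_comp_iff {ι : Type*} (K : Submodule F Y) (v : ι → Y) :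
    LinearIndependent F (K.mkQ ∘ v) ↔
      LinearIndependent F v ∧ Disjoint (span F (Set.range v)) K := by
  constructor
  · intro h
    refine ⟨h.of_comp _, disjoint_def.2 fun x hx hxK => ?_⟩
    obtain ⟨c, rfl⟩ := (Finsupp.mem_span_range_iff_exists_finsupp).1 hx
    have h0 : K.mkQ (c.sum fun i a => a • v i) = 0 := by simpa using hxK
    rw [map_finsuppSum] at h0
    have hc : c = 0 := linearIndependent_iff.1 h c (by
      rw [Finsupp.linearCombination_apply]
      simpa using h0)
    simp [hc]
  · rintro ⟨h, hd⟩
    exact (LinearMap.linearIndependent_iff_of_disjoint _ (by simpa using hd)).2 h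

variable [Fintype F] [Finite Y]

/-- The number of linearly independent `s`-tuples, as a rational product valid for every `s`. -/
theorem natCard_linearIndependent (s : ℕ) :
    (Nat.card {v : Fin s → Y // LinearIndependent F v} : ℚ) =
      ∏ l ∈ Finset.range s, ((Fintype.card F : ℚ) ^ finrank F Y - (Fintype.card F : ℚ) ^ l) := by
  rcases le_or_gt s (finrank F Y) with h | h
  · rw [card_linearIndependent h, Finset.prod_range, Nat.cast_prod]
    refine Finset.prod_congr rfl fun i _ => ?_
    rw [Nat.cast_sub (Nat.pow_le_pow_right Fintype.card_pos (i.2.le.trans h))]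
    push_cast
    rfl
  · have : IsEmpty {v : Fin s → Y // LinearIndependent F v} :=
      ⟨fun v => h.not_ge (by simpa using v.2.fintype_card_le_finrank)⟩
    rw [Finset.prod_eq_zero (Finset.mem_range.2 h) (sub_self _)]
    simp

/-- Tuples independent modulo `K` correspond to an independent tuple of the quotient
together with a tuple of elements of `K`. -/
theorem natCard_linearIndependent_mkQ_comp (K : Submodule F Y) (s : ℕ) :
    Nat.card {v : Fin s → Y // LinearIndependent F (K.mkQ ∘ v)} =
      Fintype.card F ^ (finrank F K * s) *
        Nat.card {u : Fin s → Y ⧸ K // LinearIndependent F u} := by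
  obtain ⟨σ, hσ⟩ := K.mkQ.exists_rightInverse_of_surjective (range_mkQ K)
  have hσ' : ∀ x, K.mkQ (σ x) = x := fun x => LinearMap.congr_fun hσ x
  have e : {v : Fin s → Y // LinearIndependent F (K.mkQ ∘ v)} ≃
      (Fin s → K) × {u : Fin s → Y ⧸ K // LinearIndependent F u} :=
    { toFun := fun v => (fun i => ⟨v.1 i - σ (K.mkQ (v.1 i)), by
        have h0 : K.mkQ (v.1 i - σ (K.mkQ (v.1 i))) = 0 := by rw [map_sub, hσ', sub_self]
        simpa only [mkQ_apply, Quotient.mk_eq_zero] using h0⟩,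
        ⟨K.mkQ ∘ v.1, v.2⟩)
      invFun := fun p => ⟨fun i => (p.1 i : Y) + σ (p.2.1 i), by
        have : K.mkQ ∘ (fun i => (p.1 i : Y) + σ (p.2.1 i)) = p.2.1 := by
          funext i
          have h0 : K.mkQ (p.1 i : Y) = 0 := by simp
          simp only [Function.comp_apply, map_add, hσ', h0, zero_add]
        rw [this]
        exact p.2.2⟩
      left_inv := fun v => by
        ext i
        simp
      right_inv := fun p => by
        have h : ∀ i, K.mkQ ((p.1 i : Y) + σ (p.2.1 i)) = p.2.1 i := fun i => by
          have h0 : K.mkQ (p.1 i : Y) = 0 := by simp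
          rw [map_add, hσ', h0, zero_add]
        refine Prod.ext (funext fun i => Subtype.ext ?_) (Subtype.ext (funext fun i => h i))
        simp only [h, add_sub_cancel_right] }
  have := Fintype.ofFinite K
  rw [Nat.card_congr e, Nat.card_prod, Nat.card_fun, Nat.card_eq_fintype_card (α := K),
    Module.card_eq_pow_finrank (K := F) (V := K), ← pow_mul]
  simp

/-- Tuples independent modulo `K`, sorted by their span. -/
theorem natCard_linearIndependent_mkQ_comp_eq_mul (K : Submodule F Y) (s : ℕ) :
    (Nat.card {v : Fin s → Y // LinearIndependent F (K.mkQ ∘ v)} : ℚ) =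
      Nat.card {U : Submodule F Y // finrank F U = s ∧ Disjoint U K} *
        ∏ l ∈ Finset.range s, ((Fintype.card F : ℚ) ^ s - (Fintype.card F : ℚ) ^ l) := by
  let f (v : {v : Fin s → Y // LinearIndependent F (K.mkQ ∘ v)}) :
      {U : Submodule F Y // finrank F U = s ∧ Disjoint U K} :=
    have h := (linearIndependent_mkQ_comp_iff K v.1).1 v.2
    ⟨span F (Set.range v.1), by simpa using finrank_span_eq_card h.1, h.2⟩
  have e (U : {U : Submodule F Y // finrank F U = s ∧ Disjoint U K}) :
      {v // f v = U} ≃ {w : Fin s → U.1 // LinearIndependent F w} :=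
    { toFun := fun v =>
        have hv : span F (Set.range v.1.1) = U.1 := congrArg Subtype.val v.2
        ⟨fun i => ⟨v.1.1 i, hv ▸ subset_span ⟨i, rfl⟩⟩,
          LinearIndependent.of_comp U.1.subtype
            ((linearIndependent_mkQ_comp_iff K v.1.1).1 v.1.2).1⟩
      invFun := fun w =>
        have hle : span F (Set.range fun i => (w.1 i : Y)) ≤ U.1 := by
          rw [span_le]
          rintro _ ⟨i, rfl⟩
          exact (w.1 i).2
        have hli : LinearIndependent F fun i => (w.1 i : Y) :=
          w.2.map' U.1.subtype (ker_subtype _)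
        ⟨⟨fun i => (w.1 i : Y),
          (linearIndependent_mkQ_comp_iff K _).2 ⟨hli, U.2.2.mono_left hle⟩⟩,
          Subtype.ext (eq_of_le_of_finrank_eq hle ((f _).2.1.trans U.2.1.symm))⟩
      left_inv := fun v => rfl
      right_inv := fun w => rfl }
  have := Fintype.ofFinite {U : Submodule F Y // finrank F U = s ∧ Disjoint U K}
  rw [← Nat.card_congr (Equiv.sigmaFiberEquiv f), Nat.card_sigma, Nat.cast_sum,
    Finset.sum_congr rfl fun U _ => by
      rw [Nat.card_congr (e U), natCard_linearIndependent (F := F) (Y := U.1) s, U.2.1]]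
  simp

theorem prod_pow_sub_pow_ne_zero {q : ℕ} (hq : 2 ≤ q) (s : ℕ) :
    ∏ l ∈ Finset.range s, ((q : ℚ) ^ s - (q : ℚ) ^ l) ≠ 0 := by
  refine Finset.prod_ne_zero_iff.2 fun l hl => sub_ne_zero.2 (ne_of_gt ?_)
  exact pow_lt_pow_right₀ (by exact_mod_cast hq) (Finset.mem_range.1 hl)

/-- The number of `s`-dimensional subspaces meeting `K` trivially. -/
theorem natCard_finrank_eq_and_disjoint (K : Submodule F Y) (s : ℕ) :
    (Nat.card {U : Submodule F Y // finrank F U = s ∧ Disjoint U K} : ℚ) =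
      qBin (Fintype.card F) (finrank F (Y ⧸ K)) s *
        (Fintype.card F : ℚ) ^ (finrank F K * s) := by
  have h := natCard_linearIndependent_mkQ_comp_eq_mul (F := F) K s
  have : Finite (Y ⧸ K) := Finite.of_surjective _ K.mkQ_surjective
  rw [natCard_linearIndependent_mkQ_comp, Nat.cast_mul, natCard_linearIndependent] at h
  rw [qBin, Finset.prod_div_distrib]
  have h0 := prod_pow_sub_pow_ne_zero (Fintype.one_lt_card (α := F)) s
  field_simp
  push_cast at h
  rw [← h, mul_comm]

/-- The number of `s`-dimensional subspaces. -/
theorem natCard_finrank_eq (s : ℕ) :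
    (Nat.card {U : Submodule F Y // finrank F U = s} : ℚ) =
      qBin (Fintype.card F) (finrank F Y) s := by
  have h := natCard_finrank_eq_and_disjoint (F := F) (Y := Y) ⊥ s
  simpa [(quotEquivOfEqBot (⊥ : Submodule F Y) rfl).finrank_eq] using h

/-- The number of `s`-dimensional subspaces of a given subspace. -/
theorem natCard_le_and_finrank_eq (V : Submodule F Y) (s : ℕ) :
    (Nat.card {U : Submodule F Y // U ≤ V ∧ finrank F U = s} : ℚ) =
      qBin (Fintype.card F) (finrank F V) s := by
  rw [← natCard_finrank_eq (F := F) (Y := V) s]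
  congr 1
  refine Nat.card_congr
    (((MapSubtype.orderIso V).toEquiv.subtypeEquiv (q := fun U => finrank F U.1 = s) fun U => ?_).trans
      (Equiv.subtypeSubtypeEquivSubtypeInter (fun U => U ≤ V) fun U => finrank F U = s)).symm
  change _ ↔ finrank F (map V.subtype U) = s
  rw [finrank_map_subtype_eq]

/-- The number of subspaces of dimension `t + s` whose intersection with `V` is a given
`t`-dimensional subspace `T` of `V`. -/
theorem natCard_inf_eq_and_finrank_eq {T V : Submodule F Y} (hTV : T ≤ V) (s : ℕ) :
    (Nat.card {U : Submodule F Y // U ⊓ V = T ∧ finrank F U = finrank F T + s} : ℚ) =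
      qBin (Fintype.card F) (finrank F Y - finrank F V) s *
        (Fintype.card F : ℚ) ^ ((finrank F V - finrank F T) * s) := by
  have : Finite (Y ⧸ T) := Finite.of_surjective _ T.mkQ_surjective
  have hfin : ∀ W : Submodule F (Y ⧸ T),
      finrank F (comap T.mkQ W) = finrank F T + finrank F W := fun W => by
    have h := (quotientQuotientEquivQuotient T (comap T.mkQ W) (le_comap_mkQ T W)).finrank_eq
    rw [map_comap_eq_of_surjective T.mkQ_surjective] at h
    have h1 := finrank_quotient_add_finrank W
    have h2 := finrank_quotient_add_finrank T
    have h3 := finrank_quotient_add_finrank (comap T.mkQ W)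
    omega
  have hV : comap T.mkQ (map T.mkQ V) = V := by simpa using hTV
  have h := natCard_finrank_eq_and_disjoint (F := F) (map T.mkQ V) s
  have h1 := hfin (map T.mkQ V)
  rw [hV] at h1
  have h2 := finrank_quotient_add_finrank (map T.mkQ V)
  have h3 := finrank_quotient_add_finrank T
  rw [show finrank F Y - finrank F V = finrank F ((Y ⧸ T) ⧸ map T.mkQ V) by omega,
    show finrank F V - finrank F T = finrank F (map T.mkQ V) by omega, ← h]
  congr 1
  refine Nat.card_congr (Equiv.symm ?_)
  refine (((comapMkQRelIso T).toEquiv.subtypeEquiv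
      (q := fun U => U.1 ⊓ V = T ∧ finrank F U.1 = finrank F T + s) fun W => ?_).trans
      (Equiv.subtypeSubtypeEquivSubtype (p := fun U => U ∈ Set.Ici T)
        (q := fun U => U ⊓ V = T ∧ finrank F U = finrank F T + s) fun {U} hU => ?_))
  · change _ ↔ comap T.mkQ W ⊓ V = T ∧ finrank F (comap T.mkQ W) = finrank F T + s
    rw [hfin, and_comm, add_right_inj]
    refine and_congr_left fun _ => ?_
    rw [← hV, ← comap_inf, hV, disjoint_iff]
    constructor
    · intro h
      rw [h, ← LinearMap.ker, ker_mkQ]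
    · intro h
      refine comap_injective_of_surjective (mkQ_surjective T) ?_
      rw [h, ← LinearMap.ker, ker_mkQ]
  · exact hU.1.ge.trans inf_le_left

end Counting

section QBinomial

/-- The product `∏_{m=1}^{n} (q^m − 1)`. -/
def qFac (q n : ℕ) : ℚ :=
  ∏ l ∈ Finset.range n, ((q : ℚ) ^ (l + 1) - 1)

theorem qFac_succ (q n : ℕ) : qFac q (n + 1) = qFac q n * ((q : ℚ) ^ (n + 1) - 1) :=
  Finset.prod_range_succ _ _

theorem qFac_ne_zero {q : ℕ} (hq : 2 ≤ q) (n : ℕ) : qFac q n ≠ 0 := by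
  refine Finset.prod_ne_zero_iff.2 fun l _ => sub_ne_zero.2 (ne_of_gt ?_)
  exact one_lt_pow₀ (by exact_mod_cast hq) l.succ_ne_zero

theorem prod_pow_sub_pow_mul_qFac (q a j : ℕ) :
    (∏ l ∈ Finset.range j, ((q : ℚ) ^ (a + j) - (q : ℚ) ^ l)) * qFac q a =
      (∏ l ∈ Finset.range j, (q : ℚ) ^ l) * qFac q (a + j) := by
  induction j generalizing a with
  | zero => simp
  | succ j ih =>
    have h := ih (a + 1)
    rw [qFac_succ, show a + 1 + j = a + (j + 1) by ring] at h
    rw [Finset.prod_range_succ, Finset.prod_range_succ (fun l => (q : ℚ) ^ l)]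
    linear_combination (q : ℚ) ^ j * h

/-- The factorial formula for `q`-binomial coefficients. -/
theorem qBin_eq_qFac {q : ℕ} (hq : 2 ≤ q) {n j : ℕ} (h : j ≤ n) :
    qBin q n j = qFac q n / (qFac q j * qFac q (n - j)) := by
  obtain ⟨a, rfl⟩ := Nat.exists_eq_add_of_le' h
  have h1 := prod_pow_sub_pow_mul_qFac q a j
  have h2 := prod_pow_sub_pow_mul_qFac q 0 j
  have h0 := qFac_ne_zero hq
  have hp : (∏ l ∈ Finset.range j, (q : ℚ) ^ l) ≠ 0 :=
    Finset.prod_ne_zero_iff.2 fun l _ => pow_ne_zero _ (by positivity)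
  rw [zero_add, show qFac q 0 = 1 from Finset.prod_range_zero _, mul_one] at h2
  rw [qBin, Finset.prod_div_distrib, h2, Nat.add_sub_cancel, div_eq_div_iff
    (mul_ne_zero hp (h0 _)) (mul_ne_zero (h0 _) (h0 _))]
  linear_combination qFac q j * h1

/-- Partial alternating sums of `q`-binomial coefficients telescope. -/
theorem sum_neg_one_pow_mul_qFac {q : ℕ} (hq : 2 ≤ q) (M a : ℕ) :
    ∑ m ∈ Finset.range (M + 1), (-1 : ℚ) ^ m * (q : ℚ) ^ m.choose 2 *
        (qFac q (a + M + 1) / (qFac q m * qFac q (a + M + 1 - m))) =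
      (-1 : ℚ) ^ M * (q : ℚ) ^ (M + 1).choose 2 * (qFac q (a + M) / (qFac q M * qFac q a)) := by
  have h0 := qFac_ne_zero hq
  induction M generalizing a with
  | zero =>
    simp [show qFac q 0 = 1 from Finset.prod_range_zero _, div_self (h0 _)]
  | succ M ih =>
    have h := ih (a + 1)
    rw [Finset.sum_range_succ, show a + (M + 1) + 1 = a + 1 + M + 1 by ring, h,
      show a + 1 + M + 1 - (M + 1) = a + 1 by omega, show a + (M + 1) = a + 1 + M by ring,
      show (M + 1 + 1).choose 2 = (M + 1).choose 2 + (M + 1) by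
        rw [Nat.choose_succ_succ' (M + 1) 1, Nat.choose_one_right]; ring]
    have h1 := h0 M
    have h2 := h0 a
    have h3 := h0 (a + 1)
    have h4 := h0 (M + 1)
    have h5 : (q : ℚ) ^ (M + 1) - 1 ≠ 0 := fun h => h4 (by rw [qFac_succ, h, mul_zero])
    have h6 : (q : ℚ) ^ (a + 1) - 1 ≠ 0 := fun h => h3 (by rw [qFac_succ, h, mul_zero])
    rw [qFac_succ q (a + 1 + M), qFac_succ q M, qFac_succ q a, pow_succ (-1 : ℚ) M, pow_add (q : ℚ) _ (M + 1),
      show a + 1 + M + 1 = (a + 1) + (M + 1) by ring, pow_add (q : ℚ) (a + 1)]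
    generalize (q : ℚ) ^ (M + 1) = x at *
    generalize (q : ℚ) ^ (a + 1) = y at *
    field_simp
    ring

theorem sum_neg_one_pow_mul_qBin {q : ℕ} (hq : 2 ≤ q) (r : ℕ) :
    ∑ m ∈ Finset.range (r + 1), (-1 : ℚ) ^ m * (q : ℚ) ^ m.choose 2 * qBin q r m =
      if r = 0 then 1 else 0 := by
  rcases r with _ | r
  · simp [qBin]
  have h0 := qFac_ne_zero hq
  have h := sum_neg_one_pow_mul_qFac hq r 0
  rw [Finset.sum_range_succ, Finset.sum_congr rfl fun m hm => by
    rw [qBin_eq_qFac hq (show m ≤ r + 1 from (Finset.mem_range.1 hm).le)]]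
  simp only [zero_add] at h
  have e0 : qFac q 0 = 1 := Finset.prod_range_zero _
  rw [h, qBin_eq_qFac hq le_rfl, Nat.sub_self, e0, mul_one, mul_one, div_self (h0 _),
    div_self (h0 _), pow_succ]
  simp

/-- `q`-binomial inversion. -/
theorem sum_qBin_inversion {q : ℕ} (hq : 2 ≤ q) {N ρ j : ℕ} (hρ : ρ ≤ N) :
    ∑ i ∈ Finset.range (ρ + 1), (-1 : ℚ) ^ (ρ - i) * (q : ℚ) ^ Nat.choose (ρ - i) 2 *
        qBin q (N - i) (ρ - i) * (if j ≤ i then qBin q (N - j) (i - j) else 0) =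
      if j = ρ then 1 else 0 := by
  rcases lt_or_ge ρ j with h | h
  · rw [if_neg h.ne']
    refine Finset.sum_eq_zero fun i hi => ?_
    rw [if_neg (by have := Finset.mem_range.1 hi; omega), mul_zero]
  obtain ⟨r, rfl⟩ := Nat.exists_eq_add_of_le h
  have h0 := qFac_ne_zero hq
  have key : ∀ m ∈ Finset.range (j + r + 1),
      (-1 : ℚ) ^ (j + r - (j + r - m)) * (q : ℚ) ^ Nat.choose (j + r - (j + r - m)) 2 *
        qBin q (N - (j + r - m)) (j + r - (j + r - m)) *
        (if j ≤ j + r - m then qBin q (N - j) (j + r - m - j) else 0) =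
      if m < r + 1 then
        qBin q (N - j) r * ((-1 : ℚ) ^ m * (q : ℚ) ^ m.choose 2 * qBin q r m) else 0 := by
    intro m hm
    have hm := Finset.mem_range.1 hm
    rcases lt_or_ge m (r + 1) with hmr | hmr
    · rw [if_pos hmr, if_pos (by omega), show j + r - (j + r - m) = m by omega,
        qBin_eq_qFac hq (show m ≤ N - (j + r - m) by omega),
        qBin_eq_qFac hq (show j + r - m - j ≤ N - j by omega),
        qBin_eq_qFac hq (show r ≤ N - j by omega), qBin_eq_qFac hq (show m ≤ r by omega),
        show N - (j + r - m) - m = N - j - r by omega, show j + r - m - j = r - m by omega,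
        show N - j - (r - m) = N - (j + r - m) by omega]
      have := h0 (N - (j + r - m))
      have := h0 m
      have := h0 (N - j - r)
      have := h0 (r - m)
      have := h0 r
      field_simp
    · rw [if_neg hmr.not_gt, if_neg (by omega), mul_zero]
  rw [← Finset.sum_range_reflect]
  simp only [Nat.add_sub_cancel]
  rw [Finset.sum_congr rfl key, ← Finset.sum_filter,
    show (Finset.range (j + r + 1)).filter (fun m => m < r + 1) = Finset.range (r + 1) by
      ext m; simp; omega,
    ← Finset.mul_sum, sum_neg_one_pow_mul_qBin hq]
  rcases r with _ | r
  · simp [qBin]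
  · simp

end QBinomial

section PointSets

open scoped Classical in
/-- The lines contained in `U` but not in `V`. -/
noncomputable def linesAvoiding {F Y : Type*} [Field F] [AddCommGroup Y] [Module F Y]
    [Fintype (Submodule F Y)] (U V : Submodule F Y) : Finset (Submodule F Y) :=
  Finset.univ.filter fun L => finrank F L = 1 ∧ L ≤ U ∧ ¬ L ≤ V

variable {F Y : Type*} [Field F] [AddCommGroup Y] [Module F Y] [Fintype (Submodule F Y)]

theorem mem_linesAvoiding {U V L : Submodule F Y} :
    L ∈ linesAvoiding U V ↔ finrank F L = 1 ∧ L ≤ U ∧ ¬ L ≤ V := by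
  simp [linesAvoiding]

open scoped Classical in
/-- The number of `ℓ`-subsets of lines avoiding `V` and contained in `U`, sorted by their span. -/
theorem choose_card_linesAvoiding (U V : Submodule F Y) (ℓ : ℕ) :
    (linesAvoiding U V).card.choose ℓ =
      ∑ U' with U' ≤ U, (((linesAvoiding ⊤ V).powersetCard ℓ).filter
        fun P => P.sup id = U').card := by
  rw [← Finset.card_powersetCard, Finset.card_eq_sum_card_fiberwise
    (f := fun P : Finset (Submodule F Y) => P.sup id) (t := Finset.univ.filter fun U' => U' ≤ U)]
  · refine Finset.sum_congr rfl fun U' hU' => congrArg _ (Finset.ext fun P => ?_)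
    have hU' := (Finset.mem_filter.1 hU').2
    simp only [Finset.mem_filter, Finset.mem_powersetCard]
    refine and_congr_left fun hP => and_congr_left fun _ => ?_
    constructor
    · intro h L hL
      have := mem_linesAvoiding.1 (h hL)
      exact mem_linesAvoiding.2 ⟨this.1, le_top, this.2.2⟩
    · intro h L hL
      have := mem_linesAvoiding.1 (h hL)
      have hLP : L ≤ P.sup id := Finset.le_sup (f := id) hL
      exact mem_linesAvoiding.2 ⟨this.1, (hLP.trans hP.le).trans hU', this.2.2⟩
  · intro P hP
    have hP := (Finset.mem_powersetCard.1 (Finset.mem_coe.1 hP)).1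
    simp only [Finset.coe_filter, Finset.mem_univ, true_and, Set.mem_ofPred_eq]
    exact Finset.sup_le fun L hL => (mem_linesAvoiding.1 (hP hL)).2.1

variable [Fintype F] [Finite Y]

open scoped Classical in
theorem card_linesAvoiding (U V : Submodule F Y) :
    (linesAvoiding U V).card =
      (Fintype.card F ^ finrank F U - Fintype.card F ^ finrank F ↥(U ⊓ V)) /
        (Fintype.card F - 1) := by
  have hq : 1 < Fintype.card F := Fintype.one_lt_card
  have hq' : (Fintype.card F : ℚ) - 1 ≠ 0 := sub_ne_zero.2 (by exact_mod_cast hq.ne')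
  have hlines : ∀ W : Submodule F Y,
      (((Finset.univ.filter fun L : Submodule F Y => L ≤ W ∧ finrank F L = 1).card : ℕ) : ℚ) *
        ((Fintype.card F : ℚ) - 1) = (Fintype.card F : ℚ) ^ finrank F W - 1 := fun W => by
    have h := natCard_le_and_finrank_eq W 1
    rw [Nat.card_eq_fintype_card, Fintype.card_subtype] at h
    rw [h, qBin, Finset.prod_range_one, pow_zero, pow_one, div_mul_cancel₀ _ hq']
  have hsum : (Finset.univ.filter fun L : Submodule F Y => L ≤ U ∧ finrank F L = 1).card =
      (Finset.univ.filter fun L : Submodule F Y => L ≤ U ⊓ V ∧ finrank F L = 1).card +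
        (linesAvoiding U V).card := by
    rw [← Finset.card_filter_add_card_filter_not (fun L => L ≤ V), Finset.filter_filter,
      Finset.filter_filter]
    congr 2
    · ext L
      simp only [Finset.mem_filter, Finset.mem_univ, true_and, le_inf_iff]
      tauto
    · ext L
      simp only [Finset.mem_filter, Finset.mem_univ, true_and, mem_linesAvoiding]
      tauto
  have hle : Fintype.card F ^ finrank F ↥(U ⊓ V) ≤ Fintype.card F ^ finrank F U :=
    Nat.pow_le_pow_right hq.le (finrank_mono inf_le_left)
  refine (Nat.div_eq_of_eq_mul_left (Nat.sub_pos_of_lt hq) ?_).symm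
  have h1 := hlines U
  have h2 := hlines (U ⊓ V)
  rw [hsum] at h1
  have : (((Fintype.card F ^ finrank F U - Fintype.card F ^ finrank F ↥(U ⊓ V) : ℕ)) : ℚ) =
      (((linesAvoiding U V).card * (Fintype.card F - 1) : ℕ) : ℚ) := by
    push_cast [Nat.cast_sub hle, Nat.cast_sub hq.le] at h1 ⊢
    linear_combination h2 - h1
  exact_mod_cast this

open scoped Classical in
/-- The number of `i`-dimensional subspaces whose intersection with `V` has dimension `t`. -/
theorem card_finrank_eq_and_finrank_inf_eq (V : Submodule F Y) {i t : ℕ} (hti : t ≤ i) :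
    ((Finset.univ.filter fun U : Submodule F Y =>
        finrank F U = i ∧ finrank F ↥(U ⊓ V) = t).card : ℚ) =
      qBin (Fintype.card F) (finrank F V) t *
        qBin (Fintype.card F) (finrank F Y - finrank F V) (i - t) *
          (Fintype.card F : ℚ) ^ ((finrank F V - t) * (i - t)) := by
  rw [Finset.card_eq_sum_card_fiberwise (f := fun U => U ⊓ V)
    (t := Finset.univ.filter fun T => T ≤ V ∧ finrank F T = t)
    (by intro U hU; simp_all), Nat.cast_sum,
    Finset.sum_congr rfl (g := fun _ => qBin (Fintype.card F) (finrank F Y - finrank F V) (i - t) *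
          (Fintype.card F : ℚ) ^ ((finrank F V - t) * (i - t)))]
  · have h := natCard_le_and_finrank_eq V t
    rw [Nat.card_eq_fintype_card, Fintype.card_subtype] at h
    rw [Finset.sum_const, nsmul_eq_mul, h, mul_assoc]
  · intro T hT
    obtain ⟨hTV, hT⟩ := (Finset.mem_filter.1 hT).2
    have h := natCard_inf_eq_and_finrank_eq hTV (i - t)
    rw [Nat.card_eq_fintype_card, Fintype.card_subtype, hT] at h
    rw [← h, Finset.filter_filter]
    congr 2
    ext U
    simp only [Finset.mem_filter, Finset.mem_univ, true_and, Nat.add_sub_cancel' hti]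
    constructor
    · rintro ⟨⟨h1, -⟩, h2⟩
      exact ⟨h2, h1⟩
    · rintro ⟨h1, h2⟩
      exact ⟨⟨h2, by rw [h1, hT]⟩, h1⟩

open scoped Classical in
/-- The number of `i`-dimensional subspaces containing a given subspace. -/
theorem card_le_and_finrank_eq (T : Submodule F Y) (i : ℕ) :
    ((Finset.univ.filter fun U : Submodule F Y => finrank F U = i ∧ T ≤ U).card : ℚ) =
      if finrank F T ≤ i then
        qBin (Fintype.card F) (finrank F Y - finrank F T) (i - finrank F T) else 0 := by
  split_ifs with h
  · have h1 := natCard_inf_eq_and_finrank_eq (le_refl T) (i - finrank F T)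
    rw [Nat.card_eq_fintype_card, Fintype.card_subtype, Nat.sub_self, zero_mul, pow_zero,
      mul_one] at h1
    rw [← h1]
    congr 2
    ext U
    simp [Nat.add_sub_cancel' h, and_comm]
  · rw [Nat.cast_eq_zero, Finset.card_eq_zero, Finset.filter_eq_empty_iff]
    rintro U - ⟨rfl, hT⟩
    exact h (finrank_mono hT)

open scoped Classical in
/-- The number of `ℓ`-sets of lines avoiding `V`, summed over ambient `i`-dimensional subspaces. -/
theorem sum_choose_card_linesAvoiding (V : Submodule F Y) (ℓ i : ℕ) :
    ∑ U ∈ Finset.univ.filter fun U : Submodule F Y => finrank F U = i, ((linesAvoiding U V).card.choose ℓ : ℚ) =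
      ∑ t ∈ Finset.range (min (finrank F V) i + 1),
        (Nat.choose ((Fintype.card F ^ i - Fintype.card F ^ t) / (Fintype.card F - 1)) ℓ : ℚ) *
          qBin (Fintype.card F) (finrank F V) t *
          qBin (Fintype.card F) (finrank F Y - finrank F V) (i - t) *
          (Fintype.card F : ℚ) ^ ((finrank F V - t) * (i - t)) := by
  rw [← Finset.sum_fiberwise_of_maps_to (g := fun U : Submodule F Y => finrank F ↥(U ⊓ V))
    (t := Finset.range (min (finrank F V) i + 1))]
  · refine Finset.sum_congr rfl fun t ht => ?_
    have ht := Finset.mem_range.1 ht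
    rw [Finset.filter_filter, mul_assoc, mul_assoc, ← mul_assoc (qBin _ _ _),
      ← card_finrank_eq_and_finrank_inf_eq V (show t ≤ i by omega), mul_comm, ← nsmul_eq_mul,
      ← Finset.sum_const]
    refine Finset.sum_congr rfl fun U hU => ?_
    obtain ⟨h1, h2⟩ := (Finset.mem_filter.1 hU).2
    rw [card_linesAvoiding, h1, h2]
  · intro U hU
    have hU := (Finset.mem_filter.1 hU).2
    have h1 : finrank F ↥(U ⊓ V) ≤ finrank F U := finrank_mono inf_le_left
    have h2 : finrank F ↥(U ⊓ V) ≤ finrank F V := finrank_mono inf_le_right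
    rw [Finset.mem_range]
    omega

open scoped Classical in
/-- The number of `ℓ`-sets of lines avoiding `V` that span a subspace of dimension `ρ`. -/
theorem card_powersetCard_linesAvoiding_finrank_sup_eq (V : Submodule F Y) (ℓ : ℕ) {ρ : ℕ}
    (hρ : ρ ≤ finrank F Y) :
    ((((linesAvoiding ⊤ V).powersetCard ℓ).filter fun P : Finset (Submodule F Y) =>
      finrank F ↥(P.sup id) = ρ).card : ℚ) =
      ∑ i ∈ Finset.range (ρ + 1),
        (-1 : ℚ) ^ (ρ - i) * (Fintype.card F : ℚ) ^ Nat.choose (ρ - i) 2 *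
          qBin (Fintype.card F) (finrank F Y - i) (ρ - i) *
          ∑ U ∈ Finset.univ.filter fun U : Submodule F Y => finrank F U = i, ((linesAvoiding U V).card.choose ℓ : ℚ) := by
  set f : Submodule F Y → ℚ := fun U' =>
    ((((linesAvoiding ⊤ V).powersetCard ℓ).filter fun P => P.sup id = U').card : ℚ) with hf
  have hleft : ((((linesAvoiding ⊤ V).powersetCard ℓ).filter
      fun P : Finset (Submodule F Y) =>
      finrank F ↥(P.sup id) = ρ).card : ℚ) =
      ∑ U', f U' * if finrank F U' = ρ then 1 else 0 := by
    rw [Finset.card_eq_sum_card_fiberwise (f := fun P => P.sup id) (t := Finset.univ)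
      (by intro P hP; simp), Nat.cast_sum]
    refine Finset.sum_congr rfl fun U' _ => ?_
    rw [Finset.filter_filter, mul_ite, mul_one, mul_zero]
    split_ifs with h
    · simp only [hf]
      congr 2
      refine Finset.filter_congr fun P _ => ?_
      constructor
      · exact fun hP => hP.2
      · rintro rfl
        exact ⟨h, rfl⟩
    · rw [Nat.cast_eq_zero, Finset.card_eq_zero, Finset.filter_eq_empty_iff]
      rintro P - ⟨h1, rfl⟩
      exact h h1
  have hright : ∀ i, ∑ U ∈ Finset.univ.filter fun U : Submodule F Y => finrank F U = i,
      ((linesAvoiding U V).card.choose ℓ : ℚ) =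
      ∑ U', f U' * if finrank F U' ≤ i then
        qBin (Fintype.card F) (finrank F Y - finrank F U') (i - finrank F U') else 0 := fun i => by
    simp_rw [choose_card_linesAvoiding _ V, Nat.cast_sum, Finset.sum_filter (fun U' => U' ≤ _)]
    rw [Finset.sum_comm]
    refine Finset.sum_congr rfl fun U' _ => ?_
    rw [← card_le_and_finrank_eq, ← Finset.sum_filter, Finset.filter_filter, Finset.sum_const,
      nsmul_eq_mul, mul_comm]
  simp_rw [hleft, hright, Finset.mul_sum]
  rw [Finset.sum_comm]
  refine Finset.sum_congr rfl fun U' _ => ?_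
  rw [← sum_qBin_inversion (Fintype.one_lt_card (α := F)) hρ, Finset.mul_sum]
  exact Finset.sum_congr rfl fun i _ => by ring

end PointSets

/-- The number of pairs `(P, V)`, where `P` is a set of `ℓ` one-dimensional subspaces of
`X = F_q^N` spanning a subspace of dimension `ρ`, and `V` is a `k`-dimensional subspace
containing no element of `P`, equals `[N choose k]_q · λ_q(N, k, ℓ, ρ)`. -/
theorem stmt15 (q N k ρ ℓ : ℕ) (F : Type) [Field F] [Fintype F] (hq : Fintype.card F = q)
    (hN : 3 ≤ N) (hk1 : 1 ≤ k) (hk2 : k ≤ N - 1) (hρ1 : 2 ≤ ρ) (hρ2 : ρ ≤ N)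
    (hℓ1 : ρ ≤ ℓ) (hℓ2 : ℓ ≤ (q ^ ρ - 1) / (q - 1)) :
    (Nat.card {PV : Finset (Submodule F (Fin N → F)) × Submodule F (Fin N → F) //
        (∀ L ∈ PV.1, Module.finrank F L = 1) ∧ PV.1.card = ℓ ∧
          Module.finrank F ↥(PV.1.sup id) = ρ ∧
          Module.finrank F PV.2 = k ∧ ∀ L ∈ PV.1, ¬ L ≤ PV.2} : ℚ) =
      qBin q N k *
        ∑ i ∈ Finset.range (ρ + 1),
          (-1 : ℚ) ^ (ρ - i) * (q : ℚ) ^ Nat.choose (ρ - i) 2 * qBin q (N - i) (ρ - i) *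
            ∑ t ∈ Finset.range (min k i + 1),
              (Nat.choose ((q ^ i - q ^ t) / (q - 1)) ℓ : ℚ) * qBin q k t *
                qBin q (N - k) (i - t) * (q : ℚ) ^ ((k - t) * (i - t)) := by
  classical
  subst hq
  have := Fintype.ofFinite (Submodule F (Fin N → F))
  have hY : finrank F (Fin N → F) = N := finrank_fin_fun F
  rw [Nat.card_eq_fintype_card, Fintype.card_subtype,
    Finset.card_eq_sum_card_fiberwise (f := fun PV => PV.2)
      (t := Finset.univ.filter fun V : Submodule F (Fin N → F) => finrank F V = k)
      (by intro PV hPV; simp_all), Nat.cast_sum]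
  have hk := natCard_finrank_eq (F := F) (Y := Fin N → F) k
  rw [Nat.card_eq_fintype_card, Fintype.card_subtype, hY] at hk
  rw [← hk, ← nsmul_eq_mul, ← Finset.sum_const]
  refine Finset.sum_congr rfl fun V hV => ?_
  have hV := (Finset.mem_filter.1 hV).2
  have h := card_powersetCard_linesAvoiding_finrank_sup_eq V ℓ (hρ2.trans hY.ge)
  simp_rw [sum_choose_card_linesAvoiding, hY, hV] at h
  rw [← h]
  congr 1
  refine Finset.card_nbij' (fun PV => PV.1) (fun P => (P, V)) ?_ ?_ ?_ ?_
  · rintro ⟨P, V'⟩ hP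
    simp only [Finset.coe_filter, Finset.mem_filter, Finset.mem_univ, true_and,
      Set.mem_ofPred_eq, Finset.mem_powersetCard] at hP ⊢
    obtain ⟨⟨h1, h2, h3, -, h4⟩, rfl⟩ := hP
    exact ⟨⟨fun L hL => mem_linesAvoiding.2 ⟨h1 L hL, le_top, h4 L hL⟩, h2⟩, h3⟩
  · intro P hP
    simp only [Finset.coe_filter, Finset.mem_filter, Finset.mem_univ, true_and,
      Set.mem_ofPred_eq, Finset.mem_powersetCard, and_true] at hP ⊢
    exact ⟨fun L hL => (mem_linesAvoiding.1 (hP.1.1 hL)).1, hP.1.2, hP.2, hV,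
      fun L hL => (mem_linesAvoiding.1 (hP.1.1 hL)).2.2⟩
  · rintro ⟨P, V'⟩ hP
    exact Prod.ext rfl (Finset.mem_filter.1 hP).2.symm
  · exact fun P _ => rfl
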